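/- Let μ = ∑_{k=1}^m π_k (μ_{k1} × ⋯ × μ_{kd}) be a mixture of product measures. If the number N(μ) of separable variables satisfies N(μ) ≥ 2m − 1, then μ is identifiable. -/

import Mathlib

open MeasureTheory

/-- The mixture of product measures `∑ k, π k • (μ k 1 × ⋯ × μ k d)` on `ℝ^d`. -/
noncomputable def mixtureOfProducts {m d : ℕ}
    (π : Fin m → ℝ) (μ : Fin m → Fin d → ProbabilityMeasure ℝ) :
    Measure (Fin d → ℝ) :=
  ∑ k, ENNReal.ofReal (π k) • Measure.pi (fun j => (μ k j : Measure ℝ))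

/-- Identifiability of the mixture representation `(π, μ)`. -/
def IsIdentifiable {m d : ℕ}
    (π : Fin m → ℝ) (μ : Fin m → Fin d → ProbabilityMeasure ℝ) : Prop :=
  ∀ (π' : Fin m → ℝ) (μ' : Fin m → Fin d → ProbabilityMeasure ℝ),
    (∀ k, 0 < π' k) → (∑ k, π' k = 1) →
    mixtureOfProducts π' μ' = mixtureOfProducts π μ →
    ∃ σ : Equiv.Perm (Fin m), ∀ k : Fin m,
      π k = π' (σ k) ∧ ∀ j : Fin d, μ k j = μ' (σ k) j

section LinearAlgebra

variable {𝕜 ι X Y Z : Type*} [Field 𝕜]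

theorem LinearIndependent.exists_dual_family {V : Type*} [AddCommGroup V] [Module 𝕜 V]
    [DecidableEq ι] {v : ι → V} (hv : LinearIndependent 𝕜 v) :
    ∃ φ : ι → V →ₗ[𝕜] 𝕜, ∀ i k, φ i (v k) = if i = k then 1 else 0 := by
  obtain ⟨g, hg⟩ := (Finsupp.linearCombination 𝕜 v).exists_leftInverse_of_injective
    (LinearMap.ker_eq_bot.2 hv)
  refine ⟨fun i => (Finsupp.lapply i).comp g, fun i k => ?_⟩
  have h := LinearMap.congr_fun hg (Finsupp.single k 1)
  simp only [LinearMap.comp_apply, Finsupp.linearCombination_single, one_smul,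
    LinearMap.id_apply] at h
  simp [h, Finsupp.single_apply, eq_comm]

/-- Uniqueness of a rank decomposition of a three-way array whose first two families of factors
are linearly independent and whose third family consists of distinct factors. The factors are
normalized to be `1` at the base points. -/
theorem exists_perm_of_sum_mul_eq [Fintype ι] {w w' : ι → 𝕜}
    {a a' : ι → X → 𝕜} {b b' : ι → Y → 𝕜} {c c' : ι → Z → 𝕜} {x₀ : X} {y₀ : Y} {z₀ : Z}
    (hw : ∀ k, w k ≠ 0)
    (ha : LinearIndependent 𝕜 a) (hb : LinearIndependent 𝕜 b) (hc : Function.Injective c)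
    (ha₀ : ∀ k, a k x₀ = 1) (ha₀' : ∀ k, a' k x₀ = 1)
    (hb₀ : ∀ k, b k y₀ = 1) (hb₀' : ∀ k, b' k y₀ = 1)
    (hc₀ : ∀ k, c k z₀ = 1) (hc₀' : ∀ k, c' k z₀ = 1)
    (h : ∀ x y z, ∑ k, w k * (a k x * b k y * c k z) = ∑ k, w' k * (a' k x * b' k y * c' k z)) :
    ∃ σ : Equiv.Perm ι, ∀ k,
      w k = w' (σ k) ∧ a k = a' (σ k) ∧ b k = b' (σ k) ∧ c k = c' (σ k) := by
  classical
  obtain ⟨φ, hφ⟩ := ha.exists_dual_family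
  obtain ⟨ψ, hψ⟩ := hb.exists_dual_family
  set Q : Matrix ι ι 𝕜 := fun k l => φ k (a' l) with hQ
  set P : Matrix ι ι 𝕜 := fun l k => ψ k (b' l) with hP
  have hφh (k : ι) (y : Y) (z : Z) :
      w k * (b k y * c k z) = ∑ l, w' l * (Q k l * b' l y * c' l z) := by
    have hf : ∑ k, (w k * (b k y * c k z)) • a k = ∑ l, (w' l * (b' l y * c' l z)) • a' l := by
      ext x
      simp only [Finset.sum_apply, Pi.smul_apply, smul_eq_mul]
      convert h x y z using 2 <;> ring
    have := congrArg (φ k) hf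
    simp only [map_sum, map_smul, hφ, smul_eq_mul, mul_ite, mul_one, mul_zero,
      Finset.sum_ite_eq, Finset.mem_univ, if_true] at this
    rw [this]
    refine Finset.sum_congr rfl fun l _ => ?_
    simp only [hQ]; ring
  have hψh (k : ι) (x : X) :
      w k * a k x = ∑ l, w' l * (a' l x * P l k) := by
    have hf : ∑ k, (w k * a k x) • b k = ∑ l, (w' l * a' l x) • b' l := by
      ext y
      simp only [Finset.sum_apply, Pi.smul_apply, smul_eq_mul]
      convert h x y z₀ using 2
      · rw [hc₀]; ring
      · rw [hc₀']; ring
    have := congrArg (ψ k) hf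
    simp only [map_sum, map_smul, hψ, smul_eq_mul, mul_ite, mul_one, mul_zero,
      Finset.sum_ite_eq, Finset.mem_univ, if_true] at this
    rw [this]
    refine Finset.sum_congr rfl fun l _ => ?_
    simp only [hP]; ring
  have hφψ (k k' : ι) (z : Z) :
      (if k = k' then w k * c k z else 0) = ∑ l, w' l * (Q k l * P l k' * c' l z) := by
    have hf : (w k * c k z) • b k = ∑ l, (w' l * (Q k l * c' l z)) • b' l := by
      ext y
      simp only [Finset.sum_apply, Pi.smul_apply, smul_eq_mul]
      convert hφh k y z using 1
      · ring
      · exact Finset.sum_congr rfl fun l _ => by ring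
    have := congrArg (ψ k') hf
    simp only [map_sum, map_smul, hψ, smul_eq_mul, mul_ite, mul_one, mul_zero] at this
    simp only [eq_comm (a := k), this]
    refine Finset.sum_congr rfl fun l _ => ?_
    simp only [hP]; ring
  set R : Matrix ι ι 𝕜 := fun l k => w' l * P l k / w k with hR
  have hQR : Q * R = 1 := by
    ext k k'
    have := hφψ k k' z₀
    simp only [hc₀, hc₀', mul_one] at this
    rw [Matrix.mul_apply, Matrix.one_apply]
    calc ∑ l, Q k l * R l k' = (∑ l, w' l * (Q k l * P l k')) / w k' := by
          rw [Finset.sum_div]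
          exact Finset.sum_congr rfl fun l _ => by simp only [hR]; ring
      _ = _ := by
          rw [← this]
          split_ifs with hk
          · subst hk; exact div_self (hw k)
          · simp
  have hRQ : R * Q = 1 := mul_eq_one_comm.1 hQR
  have hcQ (z : Z) : Matrix.diagonal (fun k => c k z) * Q
      = Q * Matrix.diagonal (fun l => c' l z) := by
    have hz : Matrix.diagonal (fun k => c k z) = Q * Matrix.diagonal (fun l => c' l z) * R := by
      ext k k'
      rw [Matrix.mul_apply]
      simp only [Matrix.mul_diagonal, Matrix.diagonal_apply]
      calc _ = (if k = k' then w k * c k z else 0) / w k' := by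
            split_ifs with hk
            · subst hk; rw [mul_div_cancel_left₀ _ (hw k)]
            · simp
        _ = _ := by
            rw [hφψ, Finset.sum_div]
            exact Finset.sum_congr rfl fun l _ => by simp only [hR]; ring
    rw [hz, Matrix.mul_assoc, hRQ, Matrix.mul_one]
  have hcc {k l : ι} (hkl : Q k l ≠ 0) : c k = c' l := by
    ext z
    have := congrFun (congrFun (hcQ z) k) l
    rw [Matrix.diagonal_mul, Matrix.mul_diagonal, mul_comm] at this
    exact mul_left_cancel₀ hkl this
  have hrow (k : ι) : ∃ l, Q k l ≠ 0 := by
    by_contra! hk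
    have := congrFun (congrFun hQR k) k
    simp [Matrix.mul_apply, hk] at this
  choose σ hσ using hrow
  have hσinj : Function.Injective σ := fun k k' hkk =>
    hc ((hcc (hσ k)).trans (hkk ▸ (hcc (hσ k')).symm))
  have hσbij : Function.Bijective σ := Finite.injective_iff_bijective.1 hσinj
  have hcol (k k' : ι) (hk : k' ≠ k) : Q k' (σ k) = 0 := by
    by_contra hne
    exact hk (hc ((hcc hne).trans (hcc (hσ k)).symm))
  have haQ (k : ι) (x : X) : a k x * Q k (σ k) = a' (σ k) x := by
    have h1 (k : ι) : a k x = ∑ l, a' l x * R l k := by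
      apply mul_left_cancel₀ (hw k)
      rw [hψh, Finset.mul_sum]
      refine Finset.sum_congr rfl fun l _ => ?_
      simp only [hR]
      field_simp [hw k]
    have h2 : (fun k => a k x) = Matrix.vecMul (fun l => a' l x) R := by
      ext k; rw [h1]; rfl
    have h3 : Matrix.vecMul (fun k => a k x) Q = fun l => a' l x := by
      rw [h2, Matrix.vecMul_vecMul, hRQ, Matrix.vecMul_one]
    rw [← congrFun h3 (σ k), Matrix.vecMul, dotProduct, Finset.sum_eq_single k]
    · intro k' _ hk; rw [hcol k k' hk, mul_zero]
    · simp
  have hQone (k : ι) : Q k (σ k) = 1 := by simpa [ha₀, ha₀'] using haQ k x₀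
  have hbw (k : ι) (y : Y) : w k * b k y = w' (σ k) * b' (σ k) y := by
    have := hφh k y z₀
    simp only [hc₀, hc₀', mul_one] at this
    rw [this, Finset.sum_eq_single (σ k)]
    · rw [hQone, one_mul]
    · intro l _ hl
      obtain ⟨k', rfl⟩ := hσbij.2 l
      rw [hcol k' k (fun hk => hl (hk ▸ rfl))]; ring
    · simp
  have hww (k : ι) : w k = w' (σ k) := by simpa [hb₀, hb₀'] using hbw k y₀
  refine ⟨Equiv.ofBijective σ hσbij, fun k => ⟨hww k, ?_, ?_, hcc (hσ k)⟩⟩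
  · ext x; simpa [hQone] using haQ k x
  · ext y
    have := hbw k y
    rw [← hww] at this
    exact mul_left_cancel₀ (hw k) this

/-- Products of at least `#K - 1` normalized functions in separate variables, each of which
distinguishes the indices in `K`, satisfy no nontrivial linear relation over `K`. -/
theorem eq_zero_of_sum_mul_prod_eq_zero {J S : Type*} [DecidableEq ι] [DecidableEq J]
    {f : ι → J → S → 𝕜} {s₀ : S} (hf₀ : ∀ k j, f k j s₀ = 1) (I : Finset J)
    (hf : ∀ j ∈ I, Function.Injective fun k => f k j) (K : Finset ι) (hK : K.card ≤ I.card + 1)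
    (w : ι → 𝕜) (hw : ∀ E : J → S, ∑ k ∈ K, w k * ∏ j ∈ I, f k j (E j) = 0) :
    ∀ k ∈ K, w k = 0 := by
  induction I using Finset.induction_on generalizing K w with
  | empty =>
    intro k hk
    have hKk : K = {k} := Finset.eq_singleton_iff_unique_mem.2
      ⟨hk, fun l hl => Finset.card_le_one.1 (by simpa using hK) l hl k hk⟩
    simpa [hKk] using hw fun _ => s₀
  | insert i I hi ih =>
    intro k hk
    by_cases hex : ∃ l ∈ K, l ≠ k
    · obtain ⟨l, hl, hlk⟩ := hex
      have hupd (s : S) (E : J → S) :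
          ∑ n ∈ K, w n * (f n i s * ∏ j ∈ I, f n j (E j)) = 0 := by
        rw [← hw (Function.update E i s)]
        refine Finset.sum_congr rfl fun n _ => ?_
        rw [Finset.prod_insert hi, Function.update_self]
        congr 2
        refine Finset.prod_congr rfl fun j hj => ?_
        rw [Function.update_of_ne (ne_of_mem_of_not_mem hj hi)]
      by_contra hwk
      apply hlk
      refine hf i (Finset.mem_insert_self _ _) (funext fun s => ?_)
      have hzero := ih (fun j hj => hf j (Finset.mem_insert_of_mem hj)) (K.erase l)
        (by rw [Finset.card_erase_of_mem hl]; rw [Finset.card_insert_of_notMem hi] at hK; omega)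
        (fun n => w n * (f n i s - f l i s)) (fun E => ?_) k
        (Finset.mem_erase.2 ⟨hlk.symm, hk⟩)
      · exact (sub_eq_zero.1 ((mul_eq_zero.1 hzero).resolve_left hwk)).symm
      · rw [Finset.sum_erase _ (by simp)]
        calc _ = ∑ n ∈ K, w n * (f n i s * ∏ j ∈ I, f n j (E j))
              - f l i s * ∑ n ∈ K, w n * (f n i s₀ * ∏ j ∈ I, f n j (E j)) := by
              rw [Finset.mul_sum, ← Finset.sum_sub_distrib]
              exact Finset.sum_congr rfl fun n _ => by rw [hf₀]; ring
          _ = 0 := by rw [hupd, hupd]; ring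
    · push Not at hex
      have hKk : K = {k} := Finset.eq_singleton_iff_unique_mem.2 ⟨hk, hex⟩
      simpa [hKk, hf₀] using hw fun _ => s₀

theorem linearIndependent_prod_of_injective {J S : Type*} [Fintype ι]
    {f : ι → J → S → 𝕜} {s₀ : S} (hf₀ : ∀ k j, f k j s₀ = 1) (I : Finset J)
    (hf : ∀ j ∈ I, Function.Injective fun k => f k j) (hI : Fintype.card ι ≤ I.card + 1) :
    LinearIndependent 𝕜 fun (k : ι) (E : J → S) => ∏ j ∈ I, f k j (E j) := by
  classical
  refine Fintype.linearIndependent_iff.2 fun w hw k => ?_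
  refine eq_zero_of_sum_mul_prod_eq_zero hf₀ I hf Finset.univ hI w (fun E => ?_) k
    (Finset.mem_univ k)
  simpa using congrFun hw E

theorem eq_of_prod_eq_prod {J S : Type*} {f g : J → S → 𝕜} {s₀ : S}
    (hf₀ : ∀ j, f j s₀ = 1) (hg₀ : ∀ j, g j s₀ = 1) {I : Finset J}
    (h : (fun E : J → S => ∏ j ∈ I, f j (E j)) = fun E => ∏ j ∈ I, g j (E j))
    {i : J} (hi : i ∈ I) : f i = g i := by
  classical
  have key (f : J → S → 𝕜) (hf₀ : ∀ j, f j s₀ = 1) (s : S) :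
      ∏ j ∈ I, f j (Function.update (fun _ => s₀) i s j) = f i s := by
    rw [Finset.prod_eq_single_of_mem i hi fun j _ hj => by
      rw [Function.update_of_ne hj, hf₀], Function.update_self]
  ext s
  rw [← key f hf₀, ← key g hg₀]
  exact congrFun h _

/-- Uniqueness of a decomposition into products of normalized functions, when at least
`2 * card ι - 1` of the variables distinguish all indices. -/
theorem exists_perm_of_sum_mul_prod_eq {J S : Type*} [Fintype ι] [Fintype J]
    {w w' : ι → 𝕜} {f g : ι → J → S → 𝕜} {s₀ : S}
    (hf₀ : ∀ k j, f k j s₀ = 1) (hg₀ : ∀ k j, g k j s₀ = 1) (hw : ∀ k, w k ≠ 0)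
    (T : Finset J) (hT : ∀ j ∈ T, Function.Injective fun k => f k j)
    (hcard : 2 * Fintype.card ι - 1 ≤ T.card) (hι : 0 < Fintype.card ι)
    (h : ∀ E : J → S, ∑ k, w k * ∏ j, f k j (E j) = ∑ k, w' k * ∏ j, g k j (E j)) :
    ∃ σ : Equiv.Perm ι, ∀ k, w k = w' (σ k) ∧ f k = g (σ k) := by
  classical
  obtain ⟨A, hAT, hA⟩ := Finset.exists_subset_card_eq
    (show Fintype.card ι - 1 ≤ T.card by omega)
  obtain ⟨B, hBT, hB⟩ := Finset.exists_subset_card_eq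
    (show Fintype.card ι - 1 ≤ (T \ A).card by
      rw [Finset.card_sdiff_of_subset hAT]; omega)
  obtain ⟨u, hu⟩ : ((T \ A) \ B).Nonempty := by
    rw [← Finset.card_pos, Finset.card_sdiff_of_subset hBT, Finset.card_sdiff_of_subset hAT]
    omega
  simp only [Finset.mem_sdiff] at hu
  set C : Finset J := Finset.univ.filter fun j => j ∉ A ∧ j ∉ B with hC
  have hAB : ∀ j ∈ B, j ∉ A := fun j hj => (Finset.mem_sdiff.1 (hBT hj)).2
  have hsplit (f : J → S → 𝕜) (x y z : J → S) :
      ∏ j, f j (if j ∈ A then x j else if j ∈ B then y j else z j)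
        = (∏ j ∈ A, f j (x j)) * (∏ j ∈ B, f j (y j)) * ∏ j ∈ C, f j (z j) := by
    have hunion : (Finset.univ : Finset J) = (A ∪ B) ∪ C := by
      ext j; simp only [hC, Finset.mem_univ, Finset.mem_union, Finset.mem_filter]; tauto
    have hd : Disjoint (A ∪ B) C := by
      rw [Finset.disjoint_left]; intro j; simp only [hC, Finset.mem_union, Finset.mem_filter]
      tauto
    have hd' : Disjoint A B := Finset.disjoint_right.2 hAB
    rw [hunion, Finset.prod_union hd, Finset.prod_union hd']
    congr 1
    · congr 1
      · exact Finset.prod_congr rfl fun j hj => by rw [if_pos hj]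
      · exact Finset.prod_congr rfl fun j hj => by rw [if_neg (hAB j hj), if_pos hj]
    · refine Finset.prod_congr rfl fun j hj => ?_
      obtain ⟨-, hjA, hjB⟩ := Finset.mem_filter.1 hj
      rw [if_neg hjA, if_neg hjB]
  have huC : u ∈ C := by simp [hC, hu.1.2, hu.2]
  obtain ⟨σ, hσ⟩ := exists_perm_of_sum_mul_eq (w := w) (w' := w')
    (a := fun k (E : J → S) => ∏ j ∈ A, f k j (E j))
    (a' := fun k (E : J → S) => ∏ j ∈ A, g k j (E j))
    (b := fun k (E : J → S) => ∏ j ∈ B, f k j (E j))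
    (b' := fun k (E : J → S) => ∏ j ∈ B, g k j (E j))
    (c := fun k (E : J → S) => ∏ j ∈ C, f k j (E j))
    (c' := fun k (E : J → S) => ∏ j ∈ C, g k j (E j))
    (x₀ := fun _ => s₀) (y₀ := fun _ => s₀) (z₀ := fun _ => s₀) hw
    (linearIndependent_prod_of_injective hf₀ A (fun j hj => hT j (hAT hj)) (by omega))
    (linearIndependent_prod_of_injective hf₀ B
      (fun j hj => hT j (Finset.mem_sdiff.1 (hBT hj)).1) (by omega))
    (fun k k' hk => hT u hu.1.1 (eq_of_prod_eq_prod (hf₀ k) (hf₀ k') hk huC))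
    (by simp [hf₀]) (by simp [hg₀]) (by simp [hf₀]) (by simp [hg₀]) (by simp [hf₀])
    (by simp [hg₀])
    (fun x y z => by
      simpa only [hsplit] using h fun j => if j ∈ A then x j else if j ∈ B then y j else z j)
  refine ⟨σ, fun k => ⟨(hσ k).1, funext fun j => ?_⟩⟩
  obtain ⟨-, ha, hb, hc⟩ := hσ k
  by_cases hjA : j ∈ A
  · exact eq_of_prod_eq_prod (hf₀ k) (hg₀ (σ k)) ha hjA
  by_cases hjB : j ∈ B
  · exact eq_of_prod_eq_prod (hf₀ k) (hg₀ (σ k)) hb hjB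
  · exact eq_of_prod_eq_prod (hf₀ k) (hg₀ (σ k)) hc (by simp [hC, hjA, hjB])

end LinearAlgebra

theorem mixtureOfProducts_real_pi {m d : ℕ} {π : Fin m → ℝ} (hπ : ∀ k, 0 ≤ π k)
    (μ : Fin m → Fin d → ProbabilityMeasure ℝ) (E : Fin d → Set ℝ) :
    (mixtureOfProducts π μ).real (Set.univ.pi E)
      = ∑ k, π k * ∏ j, (μ k j : Measure ℝ).real (E j) := by
  rw [Measure.real, mixtureOfProducts, Measure.finsetSum_apply, ENNReal.toReal_sum]
  · refine Finset.sum_congr rfl fun k _ => ?_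
    rw [Measure.smul_apply, Measure.pi_pi, smul_eq_mul, ENNReal.toReal_mul,
      ENNReal.toReal_ofReal (hπ k), ENNReal.toReal_prod]
    rfl
  · intro k _
    exact ENNReal.mul_ne_top ENNReal.ofReal_ne_top (measure_ne_top _ _)

theorem MeasureTheory.ProbabilityMeasure.ext_of_real {Ω : Type*} [MeasurableSpace Ω]
    {μ ν : ProbabilityMeasure Ω}
    (h : ∀ s : {s : Set Ω // MeasurableSet s}, (μ : Measure Ω).real s = (ν : Measure Ω).real s) :
    μ = ν := by
  refine Subtype.ext (Measure.ext fun s hs => ?_)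
  change (μ : Measure Ω) s = (ν : Measure Ω) s
  exact (measureReal_eq_measureReal_iff).1 (h ⟨s, hs⟩)

/-- **Separability condition.** If at least `2m − 1` of the `d` variables are separable
(i.e. have pairwise distinct component measures), then the mixture is identifiable. -/
theorem identifiability_of_separable_count {m d : ℕ} (hm : 2 ≤ m) (hd : 1 ≤ d)
    (π : Fin m → ℝ) (μ : Fin m → Fin d → ProbabilityMeasure ℝ)
    (hπ : ∀ k, 0 < π k) (hπsum : ∑ k, π k = 1)
    (hsep : 2 * m - 1 ≤
      Set.ncard {j : Fin d | ∀ k k' : Fin m, k ≠ k' → μ k j ≠ μ k' j}) :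
    IsIdentifiable π μ := by

  classical
  intro π' μ' hπ' _ hmix
  set F : (Fin m → Fin d → ProbabilityMeasure ℝ) → Fin m → Fin d →
      {s : Set ℝ // MeasurableSet s} → ℝ := fun ν k j s => (ν k j : Measure ℝ).real s with hF
  have hF₀ (ν k j) : F ν k j ⟨Set.univ, MeasurableSet.univ⟩ = 1 := by simp [hF]
  obtain ⟨σ, hσ⟩ := exists_perm_of_sum_mul_prod_eq (w := π) (w' := π') (hF₀ μ) (hF₀ μ')
    (fun k => (hπ k).ne')
    (Finset.univ.filter fun j : Fin d => ∀ k k' : Fin m, k ≠ k' → μ k j ≠ μ k' j)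
    (fun j hj k k' hk => by
      by_contra hne
      exact (Finset.mem_filter.1 hj).2 k k' hne
        (ProbabilityMeasure.ext_of_real fun s => congrFun hk s))
    (by
      rw [Fintype.card_fin]
      refine hsep.trans_eq ?_
      rw [← Set.ncard_coe_finset]
      simp)
    (by rw [Fintype.card_fin]; omega)
    (fun E => by
      simp only [hF]
      rw [← mixtureOfProducts_real_pi (fun k => (hπ k).le),
        ← mixtureOfProducts_real_pi (fun k => (hπ' k).le), hmix])
  exact ⟨σ, fun k => ⟨(hσ k).1, fun j => ProbabilityMeasure.ext_of_real fun s =>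
    congrFun (congrFun (hσ k).2 j) s⟩⟩
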